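/- Assume k ≥ 3 and let f = R·e^P as in the setup. Then for every real α with 0 < α < 1, Π_α(f) = ⋃_{i=1}^{m} { ζ ↦ e^{P(γ_i)}·A·(ζ + C)^{l_i} : A ≠ 0 with arg A = arg R̃_{γ_i}(γ_i), C ∈ ℂ } ∪ { ζ ↦ e^{A₁ζ + A₀} : A₀ ∈ ℂ, A₁ ∈ ℂ with A₁ ≠ 0 }. -/

import Mathlib

open Filter Topology Complex

noncomputable section

/-- Locally uniform convergence on `ℂ` with respect to the spherical metric,
expressed via the Euclidean criterion: near every point, either the functions
converge uniformly to `g` in the Euclidean metric, or they are eventually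
nonvanishing there and their reciprocals converge uniformly to `1/g`. -/
def SphLocUnifConv (F : ℕ → ℂ → ℂ) (g : ℂ → ℂ) : Prop :=
  ∀ z₀ : ℂ, ∃ U ∈ 𝓝 z₀,
    TendstoUniformlyOn F g atTop U ∨
    ((∀ᶠ n in atTop, ∀ w ∈ U, F n w ≠ 0) ∧
      TendstoUniformlyOn (fun n w => (F n w)⁻¹) (fun w => (g w)⁻¹) atTop U)

/-- `Π_α(h)` : the set of all nonconstant meromorphic functions `g` on `ℂ` for which
there exist `z₀ ∈ ℂ`, naturals `k n → ∞`, complex `z n → z₀` and positive reals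
`ρ n → 0` such that `ζ ↦ ρ n ^ (-α) * h (k n * z n + k n * ρ n * ζ)` converges to `g`
locally uniformly on `ℂ` in the spherical metric. -/
def PiAlpha (α : ℝ) (h : ℂ → ℂ) : Set (ℂ → ℂ) :=
  { g | MeromorphicOn g Set.univ ∧ (∀ c : ℂ, g ≠ fun _ => c) ∧
      ∃ (z₀ : ℂ) (k : ℕ → ℕ) (z : ℕ → ℂ) (ρ : ℕ → ℝ),
        Tendsto k atTop atTop ∧
        Tendsto z atTop (𝓝 z₀) ∧
        (∀ n, 0 < ρ n) ∧ Tendsto ρ atTop (𝓝 0) ∧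
        SphLocUnifConv
          (fun n ζ => ((ρ n ^ (-α) : ℝ) : ℂ) * h ((k n : ℂ) * z n + (k n : ℂ) * (ρ n : ℂ) * ζ))
          g }

lemma tendsto_shift_ratio {ι : Type*} {l : Filter ι} {v x : ι → ℂ}
    (hv : Tendsto v l (Bornology.cobounded ℂ)) (hx : Tendsto (fun n => x n / v n) l (𝓝 0))
    (c : ℂ) : Tendsto (fun n => (v n + x n - c) / (v n - c)) l (𝓝 1) := by
  have hinv : Tendsto (fun n => (v n)⁻¹) l (𝓝 0) := tendsto_inv₀_cobounded.comp hv
  have h : Tendsto (fun n => (1 + x n / v n - c * (v n)⁻¹) / (1 - c * (v n)⁻¹)) l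
      (𝓝 ((1 + 0 - c * 0) / (1 - c * 0))) :=
    ((tendsto_const_nhds.add hx).sub (hinv.const_mul c)).div
      (tendsto_const_nhds.sub (hinv.const_mul c)) (by simp)
  simp only [mul_zero, add_zero, sub_zero, div_one] at h
  refine h.congr' ?_
  filter_upwards [hv (Bornology.eventually_ne_cobounded 0)] with n hn
  have hn : v n ≠ 0 := hn
  rw [← mul_div_mul_left (v n + x n - c) (v n - c) (inv_ne_zero hn)]
  congr 1 <;> field_simp

/-- The rational function with zeros `γ i` of order `lm i` and poles `β j` of order `jp j`. -/
def ratFun {m p : ℕ} (γ : Fin m → ℂ) (β : Fin p → ℂ) (lm : Fin m → ℕ) (jp : Fin p → ℕ) (z : ℂ) :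
    ℂ :=
  (∏ i, (z - γ i) ^ lm i) / ∏ j, (z - β j) ^ jp j

section RatFun

variable {m p : ℕ} (γ : Fin m → ℂ) (β : Fin p → ℂ) (lm : Fin m → ℕ) (jp : Fin p → ℕ)

lemma ratFun_ne_zero {z : ℂ} (h₁ : ∀ i, z ≠ γ i) (h₂ : ∀ j, z ≠ β j) :
    ratFun γ β lm jp z ≠ 0 :=
  div_ne_zero (Finset.prod_ne_zero_iff.2 fun i _ => pow_ne_zero _ (sub_ne_zero.2 (h₁ i)))
    (Finset.prod_ne_zero_iff.2 fun j _ => pow_ne_zero _ (sub_ne_zero.2 (h₂ j)))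

lemma eventually_forall_ne_of_tendsto_cobounded {ι : Type*} {l : Filter ι} {v : ι → ℂ}
    (hv : Tendsto v l (Bornology.cobounded ℂ)) : ∀ᶠ n in l, ∀ i, v n ≠ γ i :=
  eventually_all.2 fun i => hv (Bornology.eventually_ne_cobounded (γ i))

lemma ratFun_eventually_ne_zero {ι : Type*} {l : Filter ι} {v : ι → ℂ}
    (hv : Tendsto v l (Bornology.cobounded ℂ)) : ∀ᶠ n in l, ratFun γ β lm jp (v n) ≠ 0 := by
  filter_upwards [eventually_forall_ne_of_tendsto_cobounded γ hv,
    eventually_forall_ne_of_tendsto_cobounded β hv] with n h₁ h₂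
  exact ratFun_ne_zero γ β lm jp h₁ h₂

lemma ratFun_shift_ratio {ι : Type*} {l : Filter ι} {v x : ι → ℂ}
    (hv : Tendsto v l (Bornology.cobounded ℂ)) (hx : Tendsto (fun n => x n / v n) l (𝓝 0)) :
    Tendsto (fun n => ratFun γ β lm jp (v n + x n) / ratFun γ β lm jp (v n)) l (𝓝 1) := by
  have h₁ := tendsto_finsetProd (Finset.univ : Finset (Fin m))
    fun i _ => (tendsto_shift_ratio hv hx (γ i)).pow (lm i)
  have h₂ := tendsto_finsetProd (Finset.univ : Finset (Fin p))
    fun j _ => (tendsto_shift_ratio hv hx (β j)).pow (jp j)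
  have h := h₁.div h₂ (by simp)
  simp only [one_pow, Finset.prod_const_one, div_one] at h
  refine h.congr fun n => ?_
  simp only [ratFun, Pi.div_apply, div_pow, Finset.prod_div_distrib]
  rw [div_div_div_comm]

lemma tendsto_log_norm_sub_div {ι : Type*} {l : Filter ι} {K : ι → ℝ} {y : ι → ℂ} {y₀ : ℂ}
    (hK : Tendsto K l atTop) (hy : Tendsto y l (𝓝 y₀)) (hy₀ : y₀ ≠ 0) {k : ℕ} (hk : k ≠ 0)
    (c : ℂ) : Tendsto (fun n => Real.log ‖(K n : ℂ) * y n - c‖ / K n ^ k) l (𝓝 0) := by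
  have hinv : Tendsto (fun n => ((K n)⁻¹ : ℝ)) l (𝓝 0) := tendsto_inv_atTop_zero.comp hK
  have hpow : Tendsto (fun n => (K n ^ k)⁻¹) l (𝓝 0) :=
    tendsto_inv_atTop_zero.comp ((tendsto_pow_atTop hk).comp hK)
  have hlog : Tendsto (fun n => Real.log (K n) / K n ^ k) l (𝓝 0) := by
    have := (isLittleO_log_rpow_atTop (r := k) (by positivity)).tendsto_div_nhds_zero
    simpa [Function.comp_def] using this.comp hK
  have hinvC : Tendsto (fun n => (((K n)⁻¹ : ℝ) : ℂ)) l (𝓝 0) := by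
    simpa [Function.comp_def] using (Complex.continuous_ofReal.tendsto 0).comp hinv
  have h₁ : Tendsto (fun n => y n - c * (((K n)⁻¹ : ℝ) : ℂ)) l (𝓝 y₀) := by
    simpa using hy.sub (hinvC.const_mul c)
  have h₂ : Tendsto (fun n => Real.log ‖y n - c * (((K n)⁻¹ : ℝ) : ℂ)‖) l (𝓝 (Real.log ‖y₀‖)) :=
    h₁.norm.log (by simpa using hy₀)
  have h := hlog.add (h₂.mul hpow)
  simp only [mul_zero, add_zero] at h
  refine h.congr' ?_
  filter_upwards [hK.eventually_gt_atTop 0, h₁.eventually_ne hy₀] with n hn hne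
  have hn' : (K n : ℂ) ≠ 0 := by exact_mod_cast hn.ne'
  have e : (K n : ℂ) * y n - c = (K n : ℂ) * (y n - c * (((K n)⁻¹ : ℝ) : ℂ)) := by
    push_cast
    field_simp
  rw [e, norm_mul, Real.log_mul (by simpa using hn') (by simpa using hne), Complex.norm_real,
    Real.norm_of_nonneg hn.le]
  ring

lemma tendsto_ofReal_mul_cobounded {ι : Type*} {l : Filter ι} {K : ι → ℝ} {y : ι → ℂ} {y₀ : ℂ}
    (hK : Tendsto K l atTop) (hy : Tendsto y l (𝓝 y₀)) (hy₀ : y₀ ≠ 0) :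
    Tendsto (fun n => (K n : ℂ) * y n) l (Bornology.cobounded ℂ) := by
  rw [← tendsto_norm_atTop_iff_cobounded]
  have h := hK.atTop_mul_pos (norm_pos_iff.2 hy₀) hy.norm
  refine h.congr' ?_
  filter_upwards [hK.eventually_ge_atTop 0] with n hn
  rw [norm_mul, Complex.norm_real, Real.norm_of_nonneg hn]

lemma tendsto_log_norm_ratFun_div {ι : Type*} {l : Filter ι} {K : ι → ℝ} {y : ι → ℂ} {y₀ : ℂ}
    (hK : Tendsto K l atTop) (hy : Tendsto y l (𝓝 y₀)) (hy₀ : y₀ ≠ 0) {k : ℕ} (hk : k ≠ 0) :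
    Tendsto (fun n => Real.log ‖ratFun γ β lm jp ((K n : ℂ) * y n)‖ / K n ^ k) l (𝓝 0) := by
  have h₁ := tendsto_finsetSum (Finset.univ : Finset (Fin m))
    fun i _ => (tendsto_log_norm_sub_div hK hy hy₀ hk (γ i)).const_mul (lm i : ℝ)
  have h₂ := tendsto_finsetSum (Finset.univ : Finset (Fin p))
    fun j _ => (tendsto_log_norm_sub_div hK hy hy₀ hk (β j)).const_mul (jp j : ℝ)
  have h := h₁.sub h₂
  simp only [mul_zero, Finset.sum_const_zero, sub_zero] at h
  have hv := tendsto_ofReal_mul_cobounded hK hy hy₀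
  refine h.congr' ?_
  filter_upwards [eventually_forall_ne_of_tendsto_cobounded γ hv,
    eventually_forall_ne_of_tendsto_cobounded β hv] with n hγ hβ
  have e₁ : ∀ i, ‖(K n : ℂ) * y n - γ i‖ ≠ 0 := fun i => by simpa [sub_eq_zero] using hγ i
  have e₂ : ∀ j, ‖(K n : ℂ) * y n - β j‖ ≠ 0 := fun j => by simpa [sub_eq_zero] using hβ j
  rw [ratFun, norm_div, norm_prod, norm_prod, Real.log_div
    (Finset.prod_ne_zero_iff.2 fun i _ => by rw [norm_pow]; exact pow_ne_zero _ (e₁ i))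
    (Finset.prod_ne_zero_iff.2 fun i _ => by rw [norm_pow]; exact pow_ne_zero _ (e₂ i)),
    Real.log_prod (fun i _ => by rw [norm_pow]; exact pow_ne_zero _ (e₁ i)),
    Real.log_prod (fun i _ => by rw [norm_pow]; exact pow_ne_zero _ (e₂ i)), sub_div,
    Finset.sum_div, Finset.sum_div]
  simp only [norm_pow, Real.log_pow, mul_div_assoc]

end RatFun

/-- The divided difference `(P (v + x) - P v) / x` as a polynomial expression in `v` and `x`. -/
def polySlope (P : Polynomial ℂ) (v x : ℂ) : ℂ :=
  ∑ j ∈ Finset.range (P.natDegree + 1),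
    P.coeff j * ∑ i ∈ Finset.range j, (v + x) ^ i * v ^ (j - 1 - i)

lemma eval_add_eq_polySlope (P : Polynomial ℂ) (v x : ℂ) :
    P.eval (v + x) = P.eval v + x * polySlope P v x := by
  rw [P.eval_eq_sum_range, P.eval_eq_sum_range, polySlope, Finset.mul_sum,
    ← Finset.sum_add_distrib]
  refine Finset.sum_congr rfl fun j _ => ?_
  have := (Commute.all (v + x) v).geom_sum₂_mul j
  rw [add_sub_cancel_left] at this
  linear_combination -P.coeff j * this

lemma tendsto_polySlope_div (P : Polynomial ℂ) {ι : Type*} {l : Filter ι} {v x : ι → ℂ}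
    (hv : Tendsto v l (Bornology.cobounded ℂ)) (hx : Tendsto (fun n => x n / v n) l (𝓝 0)) :
    Tendsto (fun n => polySlope P (v n) (x n) / v n ^ (P.natDegree - 1)) l
      (𝓝 (P.natDegree * P.leadingCoeff)) := by
  have hinv : Tendsto (fun n => (v n)⁻¹) l (𝓝 0) := tendsto_inv₀_cobounded.comp hv
  have h : Tendsto (fun n => ∑ j ∈ Finset.range (P.natDegree + 1),
      P.coeff j * ∑ i ∈ Finset.range j, (1 + x n / v n) ^ i * (v n)⁻¹ ^ (P.natDegree - j)) l
      (𝓝 (∑ j ∈ Finset.range (P.natDegree + 1),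
      P.coeff j * ∑ i ∈ Finset.range j, (1 + 0) ^ i * 0 ^ (P.natDegree - j))) :=
    tendsto_finsetSum _ fun j _ => (tendsto_finsetSum _ fun i _ =>
      ((tendsto_const_nhds.add hx).pow i).mul (hinv.pow _)).const_mul _
  have e : (∑ j ∈ Finset.range (P.natDegree + 1),
      P.coeff j * ∑ i ∈ Finset.range j, ((1 : ℂ) + 0) ^ i * 0 ^ (P.natDegree - j)) =
      P.natDegree * P.leadingCoeff := by
    rw [Finset.sum_range_succ, Finset.sum_eq_zero]
    · simp [mul_comm]
    · intro j hj
      rw [Finset.mem_range] at hj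
      simp [zero_pow (Nat.sub_ne_zero_of_lt hj)]
  rw [e] at h
  refine h.congr' ?_
  filter_upwards [hv (Bornology.eventually_ne_cobounded 0)] with n hn
  have hn : v n ≠ 0 := hn
  rw [polySlope, Finset.sum_div]
  refine Finset.sum_congr rfl fun j hj => ?_
  rw [mul_div_assoc, Finset.sum_div]
  congr 1
  refine Finset.sum_congr rfl fun i hi => ?_
  rw [Finset.mem_range] at hi hj
  obtain ⟨a, rfl⟩ : ∃ a, j = i + 1 + a := ⟨j - (i + 1), by omega⟩
  obtain ⟨b, hb⟩ : ∃ b, P.natDegree = i + 1 + a + b := ⟨P.natDegree - (i + 1 + a), by omega⟩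
  rw [hb, show i + 1 + a - 1 - i = a by omega, show i + 1 + a + b - (i + 1 + a) = b by omega,
    show i + 1 + a + b - 1 = i + a + b by omega, show 1 + x n / v n = (v n + x n) / v n by
    field_simp, div_pow, inv_pow]
  field_simp
  ring

lemma tendsto_eval_ofReal_mul_div (P : Polynomial ℂ) {ι : Type*} {l : Filter ι} {K : ι → ℝ}
    {y : ι → ℂ} {y₀ : ℂ} (hK : Tendsto K l atTop) (hy : Tendsto y l (𝓝 y₀)) :
    Tendsto (fun n => P.eval ((K n : ℂ) * y n) / (K n : ℂ) ^ P.natDegree) l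
      (𝓝 (P.leadingCoeff * y₀ ^ P.natDegree)) := by
  have hinv : Tendsto (fun n => (((K n)⁻¹ : ℝ) : ℂ)) l (𝓝 0) := by
    simpa [Function.comp_def] using
      (Complex.continuous_ofReal.tendsto 0).comp (tendsto_inv_atTop_zero.comp hK)
  have h : Tendsto (fun n => ∑ j ∈ Finset.range (P.natDegree + 1),
      P.coeff j * (y n ^ j * (((K n)⁻¹ : ℝ) : ℂ) ^ (P.natDegree - j))) l
      (𝓝 (∑ j ∈ Finset.range (P.natDegree + 1),
      P.coeff j * (y₀ ^ j * 0 ^ (P.natDegree - j)))) :=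
    tendsto_finsetSum _ fun j _ => ((hy.pow j).mul (hinv.pow _)).const_mul _
  have e : (∑ j ∈ Finset.range (P.natDegree + 1),
      P.coeff j * (y₀ ^ j * 0 ^ (P.natDegree - j))) = P.leadingCoeff * y₀ ^ P.natDegree := by
    rw [Finset.sum_range_succ, Finset.sum_eq_zero]
    · simp
    · intro j hj
      rw [Finset.mem_range] at hj
      simp [zero_pow (Nat.sub_ne_zero_of_lt hj)]
  rw [e] at h
  refine h.congr' ?_
  filter_upwards [hK.eventually_gt_atTop 0] with n hn
  have hn' : (K n : ℂ) ≠ 0 := by exact_mod_cast hn.ne'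
  rw [P.eval_eq_sum_range, Finset.sum_div]
  refine Finset.sum_congr rfl fun j hj => ?_
  rw [Finset.mem_range] at hj
  obtain ⟨b, hb⟩ : ∃ b, P.natDegree = j + b := ⟨P.natDegree - j, by omega⟩
  rw [hb, add_tsub_cancel_left]
  push_cast
  rw [mul_pow, inv_pow]
  field_simp
  ring

section RatExp

variable {m p : ℕ} (γ : Fin m → ℂ) (β : Fin p → ℂ) (lm : Fin m → ℕ) (jp : Fin p → ℕ)
  (P : Polynomial ℂ)

/-- The function `R · e ^ P`. -/
def ratExp (z : ℂ) : ℂ := ratFun γ β lm jp z * Complex.exp (P.eval z)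

lemma tendsto_log_norm_ratExp_div {ι : Type*} {l : Filter ι} {K : ι → ℝ} {y : ι → ℂ} {y₀ : ℂ}
    (hK : Tendsto K l atTop) (hy : Tendsto y l (𝓝 y₀)) (hy₀ : y₀ ≠ 0) (hP : P.natDegree ≠ 0) :
    Tendsto (fun n => Real.log ‖ratExp γ β lm jp P ((K n : ℂ) * y n)‖ / K n ^ P.natDegree) l
      (𝓝 (P.leadingCoeff * y₀ ^ P.natDegree).re) := by
  have h₁ := tendsto_log_norm_ratFun_div γ β lm jp hK hy hy₀ hP
  have h₂ := (Complex.continuous_re.tendsto _).comp (tendsto_eval_ofReal_mul_div P hK hy)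
  have h := h₁.add h₂
  rw [zero_add] at h
  refine h.congr' ?_
  filter_upwards [ratFun_eventually_ne_zero γ β lm jp
    (tendsto_ofReal_mul_cobounded hK hy hy₀)] with n hn
  rw [ratExp, norm_mul, Complex.norm_exp, Real.log_mul (by simpa using hn) (Real.exp_ne_zero _),
    Real.log_exp, add_div, Function.comp_apply, ← Complex.ofReal_pow, Complex.div_ofReal_re]

/-- Near infinity, `R · e ^ P` at a shifted point is its value at the base point times an explicit
exponential times a factor tending to `1`. -/
lemma ratExp_add_eq {v x : ℂ} (hv : ratFun γ β lm jp v ≠ 0) :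
    ratExp γ β lm jp P (v + x) = ratExp γ β lm jp P v *
      ((ratFun γ β lm jp (v + x) / ratFun γ β lm jp v) * Complex.exp (x * polySlope P v x)) := by
  rw [ratExp, ratExp, eval_add_eq_polySlope, Complex.exp_add]
  field_simp

lemma continuousAt_ratExp {z : ℂ} (hz : ∀ j, z ≠ β j) : ContinuousAt (ratExp γ β lm jp P) z := by
  unfold ratExp ratFun
  refine ContinuousAt.mul (ContinuousAt.div (by fun_prop) (by fun_prop) ?_) (by fun_prop)
  exact Finset.prod_ne_zero_iff.2 fun j _ => pow_ne_zero _ (sub_ne_zero.2 (hz j))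

variable {jp} in
lemma ratExp_eq_zero_of_pole (hjp : ∀ j, 1 ≤ jp j) (j : Fin p) :
    ratExp γ β lm jp P (β j) = 0 := by
  have : ∏ i, (β j - β i) ^ jp i = 0 :=
    Finset.prod_eq_zero (Finset.mem_univ j) (by simp [(Nat.one_le_iff_ne_zero.1 (hjp j))])
  simp [ratExp, ratFun, this]

variable {jp} in
/-- A limit of points at which `R · e ^ P` is nonzero and tends to zero is a zero of `R`. -/
lemma exists_eq_zero_of_tendsto_ratExp {ι : Type*} {l : Filter ι} [l.NeBot] {y : ι → ℂ} {y₀ : ℂ}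
    (hjp : ∀ j, 1 ≤ jp j) (hy : Tendsto y l (𝓝 y₀))
    (h0 : Tendsto (fun n => ratExp γ β lm jp P (y n)) l (𝓝 0))
    (hne : ∀ᶠ n in l, ratExp γ β lm jp P (y n) ≠ 0) : ∃ i, y₀ = γ i := by
  have hQ : Tendsto (fun n => ∏ j, (y n - β j) ^ jp j) l (𝓝 (∏ j, (y₀ - β j) ^ jp j)) :=
    ((by fun_prop : Continuous fun z : ℂ => ∏ j, (z - β j) ^ jp j).tendsto y₀).comp hy
  have hN : Tendsto (fun n => (∏ i, (y n - γ i) ^ lm i) * Complex.exp (P.eval (y n))) l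
      (𝓝 ((∏ i, (y₀ - γ i) ^ lm i) * Complex.exp (P.eval y₀))) :=
    ((by fun_prop : Continuous fun z : ℂ =>
      (∏ i, (z - γ i) ^ lm i) * Complex.exp (P.eval z)).tendsto y₀).comp hy
  have h := h0.mul hQ
  rw [zero_mul] at h
  have h' := tendsto_nhds_unique (hN.congr' ?_) h
  · rcases mul_eq_zero.1 h' with h' | h'
    · obtain ⟨i, -, hi⟩ := Finset.prod_eq_zero_iff.1 h'
      exact ⟨i, sub_eq_zero.1 (eq_zero_of_pow_eq_zero hi)⟩
    · exact absurd h' (Complex.exp_ne_zero _)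
  · filter_upwards [hne] with n hn
    have : ∏ j, (y n - β j) ^ jp j ≠ 0 := by
      refine Finset.prod_ne_zero_iff.2 fun j _ => pow_ne_zero _ (sub_ne_zero.2 ?_)
      intro hj
      exact hn (hj ▸ ratExp_eq_zero_of_pole γ β lm P hjp j)
    rw [ratExp, ratFun]
    field_simp

end RatExp

lemma Ultrafilter.tendsto_nhds_or_cobounded {ι : Type*} (u : Ultrafilter ι) (x : ι → ℂ) :
    (∃ a, Tendsto x u (𝓝 a)) ∨ Tendsto x u (Bornology.cobounded ℂ) := by
  rw [or_iff_not_imp_right, ← tendsto_norm_atTop_iff_cobounded, tendsto_atTop]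
  intro h
  push Not at h
  obtain ⟨b, hb⟩ := h
  obtain ⟨a, -, ha⟩ := (isCompact_closedBall (0 : ℂ) b).ultrafilter_le_nhds (u.map x) (by
    rw [le_principal_iff, Ultrafilter.coe_map, Filter.mem_map]
    filter_upwards [hb] with n hn
    simpa using hn.le)
  exact ⟨a, ha⟩

section Spherical

variable {F : ℕ → ℂ → ℂ} {g : ℂ → ℂ}

lemma sphLocUnifConv_of_tendsto
    (h : ∀ ζ, Tendsto (fun q : ℕ × ℂ => F q.1 q.2) (atTop ×ˢ 𝓝 ζ) (𝓝 (g ζ)))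
    (hg : Continuous g) : SphLocUnifConv F g := by
  have hloc : TendstoLocallyUniformly F g atTop := by
    rw [tendstoLocallyUniformly_iff_forall_tendsto]
    intro ζ
    exact (((hg.tendsto ζ).comp tendsto_snd).prodMk_nhds (h ζ)).mono_right
      (nhds_le_uniformity _)
  intro ζ
  exact ⟨Metric.closedBall ζ 1, Metric.closedBall_mem_nhds ζ one_pos,
    Or.inl (tendstoLocallyUniformly_iff_forall_isCompact.1 hloc _ (isCompact_closedBall ζ 1))⟩

lemma SphLocUnifConv.tendsto_of_ne_zero (h : SphLocUnifConv F g) {ζ : ℂ} (hζ : g ζ ≠ 0) :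
    Tendsto (fun n => F n ζ) atTop (𝓝 (g ζ)) := by
  obtain ⟨U, hU, h | ⟨-, h⟩⟩ := h ζ
  · exact h.tendsto_at (mem_of_mem_nhds hU)
  · simpa using (h.tendsto_at (mem_of_mem_nhds hU)).inv₀ (inv_ne_zero hζ)

lemma SphLocUnifConv.eq_of_tendsto (h : SphLocUnifConv F g) {l : Filter ℕ} [l.NeBot]
    (hl : l ≤ atTop) {ζ c : ℂ} (hc : Tendsto (fun n => F n ζ) l (𝓝 c)) : g ζ = c := by
  obtain ⟨U, hU, h | ⟨hne, h⟩⟩ := h ζ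
  · exact tendsto_nhds_unique ((h.tendsto_at (mem_of_mem_nhds hU)).mono_left hl) hc
  · have h' := (h.tendsto_at (mem_of_mem_nhds hU)).mono_left hl
    have h1 : Tendsto (fun n => (F n ζ)⁻¹ * F n ζ) l (𝓝 ((g ζ)⁻¹ * c)) := h'.mul hc
    have h2 : Tendsto (fun n => (F n ζ)⁻¹ * F n ζ) l (𝓝 1) := by
      refine tendsto_const_nhds.congr' ?_
      filter_upwards [hl hne] with n hn
      exact (inv_mul_cancel₀ (hn ζ (mem_of_mem_nhds hU))).symm
    have e := tendsto_nhds_unique h1 h2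
    have hg : g ζ ≠ 0 := by
      rintro h0
      simp [h0] at e
    field_simp at e
    exact e.symm

lemma eq_zero_of_tendstoUniformlyOn_of_eventually_eq_zero {z : ℂ} {U : Set ℂ} (hU : U ∈ 𝓝 z)
    (h : TendstoUniformlyOn F g atTop U) (hF : ∀ n, ContinuousAt (F n) z ∨ F n z = 0)
    (h0 : ∀ᶠ w in 𝓝[≠] z, g w = 0) : g z = 0 := by
  have hz := h.tendsto_at (mem_of_mem_nhds hU)
  refine tendsto_nhds_unique hz ?_
  rw [Metric.tendsto_atTop']
  intro ε hε
  obtain ⟨N, hN⟩ := eventually_atTop.1 (Metric.tendstoUniformlyOn_iff.1 h (ε / 2) (half_pos hε))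
  refine ⟨N, fun n hn => ?_⟩
  rw [dist_zero_right]
  rcases hF n with hc | hc
  · have : ∀ᶠ w in 𝓝[≠] z, ‖F n w‖ ≤ ε / 2 := by
      filter_upwards [h0, nhdsWithin_le_nhds hU] with w hw hwU
      have := hN n hn.le w hwU
      rw [hw, dist_zero_left] at this
      exact this.le
    have := le_of_tendsto (hc.norm.tendsto.mono_left nhdsWithin_le_nhds) this
    linarith
  · simpa [hc] using hε

/-- A nonconstant spherical limit of functions that are continuous off their zero sets has isolated
zeros. -/
lemma SphLocUnifConv.eventually_ne_zero (h : SphLocUnifConv F g)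
    (hF : ∀ n z, ContinuousAt (F n) z ∨ F n z = 0) (hg : MeromorphicOn g Set.univ)
    (hconst : ∀ c : ℂ, g ≠ fun _ => c) (z : ℂ) : ∀ᶠ w in 𝓝[≠] z, g w ≠ 0 := by
  rcases (hg z trivial).eventually_eq_zero_or_eventually_ne_zero with h0 | h0
  swap
  · exact h0
  exfalso
  refine hconst 0 (funext fun y => ?_)
  have hy : ∀ᶠ w in 𝓝[≠] y, g w = 0 := by
    rw [← meromorphicOrderAt_eq_top_iff] at h0 ⊢
    by_contra hy
    exact hg.meromorphicOrderAt_ne_top_of_isPreconnected isPreconnected_univ trivial trivial hy h0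
  obtain ⟨U, hU, h | ⟨-, h⟩⟩ := h y
  · exact eq_zero_of_tendstoUniformlyOn_of_eventually_eq_zero hU h (fun n => hF n y) hy
  · refine inv_eq_zero.1 (eq_zero_of_tendstoUniformlyOn_of_eventually_eq_zero
      (g := fun w => (g w)⁻¹) hU h (fun n => ?_) (hy.mono fun w hw => inv_eq_zero.2 hw))
    by_cases h0 : F n y = 0
    · exact Or.inr (by simp [h0])
    · exact Or.inl (((hF n y).resolve_right h0).inv₀ h0)

end Spherical

lemma exists_mem_of_eventually_nhdsNE {D V : Set ℂ} (hD : ∀ z, ∀ᶠ w in 𝓝[≠] z, w ∈ D)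
    (hV : IsOpen V) (hne : V.Nonempty) : ∃ z ∈ V, z ∈ D := by
  obtain ⟨z, hz⟩ := hne
  obtain ⟨w, h₁, h₂⟩ := ((hD z).and (nhdsWithin_le_nhds (hV.mem_nhds hz))).exists
  exact ⟨w, h₂, h₁⟩

section Cofactor

variable {m p : ℕ} (γ : Fin m → ℂ) (β : Fin p → ℂ) (lm : Fin m → ℕ) (jp : Fin p → ℕ)
  (P : Polynomial ℂ)

/-- The cofactor of `(z - γ i) ^ lm i` in `R · e ^ P`. -/
def zeroCofactor (i : Fin m) (z : ℂ) : ℂ :=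
  ((∏ j ∈ Finset.univ.erase i, (z - γ j) ^ lm j) / ∏ j, (z - β j) ^ jp j) *
    Complex.exp (P.eval z)

lemma ratExp_eq_mul_zeroCofactor (i : Fin m) (z : ℂ) :
    ratExp γ β lm jp P z = (z - γ i) ^ lm i * zeroCofactor γ β lm jp P i z := by
  rw [ratExp, ratFun, zeroCofactor, ← Finset.mul_prod_erase _ _ (Finset.mem_univ i)]
  ring

variable {γ β} in
lemma continuousAt_zeroCofactor (hγβ : ∀ i j, γ i ≠ β j) (i : Fin m) :
    ContinuousAt (zeroCofactor γ β lm jp P i) (γ i) := by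
  unfold zeroCofactor
  refine ContinuousAt.mul (ContinuousAt.div (by fun_prop) (by fun_prop) ?_) (by fun_prop)
  exact Finset.prod_ne_zero_iff.2 fun j _ => pow_ne_zero _ (sub_ne_zero.2 (hγβ i j))

variable {γ β} in
lemma zeroCofactor_ne_zero (hγ : Function.Injective γ) (hγβ : ∀ i j, γ i ≠ β j) (i : Fin m) :
    zeroCofactor γ β lm jp P i (γ i) ≠ 0 := by
  refine mul_ne_zero (div_ne_zero ?_ ?_) (Complex.exp_ne_zero _)
  · exact Finset.prod_ne_zero_iff.2 fun j hj =>
      pow_ne_zero _ (sub_ne_zero.2 (hγ.ne (Finset.ne_of_mem_erase hj).symm))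
  · exact Finset.prod_ne_zero_iff.2 fun j _ => pow_ne_zero _ (sub_ne_zero.2 (hγβ i j))

end Cofactor

section Limit

variable {m p : ℕ} {γ : Fin m → ℂ} {β : Fin p → ℂ} {lm : Fin m → ℕ} {jp : Fin p → ℕ}
  {P : Polynomial ℂ} {u : Ultrafilter ℕ} {w : ℕ → ℂ} {K M : ℕ → ℝ} {g : ℂ → ℂ}

lemma tendsto_zero_of_tendsto_mul {F : ℕ → ℂ} {c : ℂ} {l : Filter ℕ} (hM : Tendsto M l atTop)
    (h : Tendsto (fun n => (M n : ℂ) * F n) l (𝓝 c)) : Tendsto F l (𝓝 0) := by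
  have hinv : Tendsto (fun n => (((M n)⁻¹ : ℝ) : ℂ)) l (𝓝 0) := by
    simpa [Function.comp_def] using
      (Complex.continuous_ofReal.tendsto 0).comp (tendsto_inv_atTop_zero.comp hM)
  have h' := hinv.mul h
  rw [zero_mul] at h'
  refine h'.congr' ?_
  filter_upwards [hM.eventually_gt_atTop 0] with n hn
  have hn' : (M n : ℂ) ≠ 0 := by exact_mod_cast hn.ne'
  push_cast
  field_simp

/-- There is an open set of directions in which a monomial has positive real part. -/
lemma exists_re_mul_pow_pos {a : ℂ} (ha : a ≠ 0) {k : ℕ} (hk : k ≠ 0) :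
    ∃ y : ℂ, 0 < (a * y ^ k).re := by
  obtain ⟨y, hy⟩ := IsAlgClosed.exists_pow_nat_eq a⁻¹ (Nat.pos_of_ne_zero hk)
  exact ⟨y, by simp [hy, ha]⟩

lemma false_of_dilation_tendsto_atTop (hP : P.natDegree ≠ 0) {d : ℂ} (hM : Tendsto M u atTop)
    (hK : Tendsto K u atTop) (hw : Tendsto (fun n => w n / K n) u (𝓝 d))
    (hD : ∀ z, ∀ᶠ y in 𝓝[≠] z, g y ≠ 0)
    (hF : ∀ ζ, g ζ ≠ 0 →
      Tendsto (fun n => (M n : ℂ) * ratExp γ β lm jp P (w n + K n * ζ)) u (𝓝 (g ζ))) :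
    False := by
  have ha : P.leadingCoeff ≠ 0 := by
    rw [Polynomial.leadingCoeff_ne_zero]
    rintro rfl
    simp at hP
  obtain ⟨ζ, hζ, hgζ⟩ := exists_mem_of_eventually_nhdsNE (D := {ζ | g ζ ≠ 0})
    (V := {ζ | 0 < (P.leadingCoeff * (d + ζ) ^ P.natDegree).re}) hD
    (isOpen_lt continuous_const (by fun_prop)) (by
      obtain ⟨y, hy⟩ := exists_re_mul_pow_pos ha hP
      exact ⟨y - d, by simpa using hy⟩)
  have hne : d + ζ ≠ 0 := by
    intro h
    simp [h, hP] at hζ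
  have hy : Tendsto (fun n => w n / K n + ζ) u (𝓝 (d + ζ)) := hw.add_const ζ
  have hlog := tendsto_log_norm_ratExp_div γ β lm jp P hK hy hne hP
  have h0 := (tendsto_zero_of_tendsto_mul hM (hF ζ hgζ)).norm
  rw [norm_zero] at h0
  obtain ⟨n, h₁, h₂, h₃⟩ := ((hlog.eventually_const_lt hζ).and
    ((h0.eventually_lt_const one_pos).and (hK.eventually_gt_atTop 0))).exists
  have hn' : (K n : ℂ) ≠ 0 := by exact_mod_cast h₃.ne'
  rw [mul_add, mul_div_cancel₀ _ hn'] at h₁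
  have := Real.log_nonpos (norm_nonneg _) h₂.le
  exact absurd h₁ (not_lt.2 (div_nonpos_of_nonpos_of_nonneg this (by positivity)))

lemma exists_zero_limit (hjp : ∀ j, 1 ≤ jp j) {w₀ : ℂ} {K₀ : ℝ} (hM : Tendsto M u atTop)
    (hK : Tendsto K u (𝓝 K₀)) (hw : Tendsto w u (𝓝 w₀))
    (hD : ∀ z, ∀ᶠ y in 𝓝[≠] z, g y ≠ 0)
    (hF : ∀ ζ, g ζ ≠ 0 →
      Tendsto (fun n => (M n : ℂ) * ratExp γ β lm jp P (w n + K n * ζ)) u (𝓝 (g ζ))) :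
    K₀ = 0 ∧ ∃ i, w₀ = γ i := by
  have key : ∀ ζ, g ζ ≠ 0 → ∃ i, w₀ + K₀ * ζ = γ i := by
    intro ζ hζ
    have hy : Tendsto (fun n => w n + K n * ζ) u (𝓝 (w₀ + K₀ * ζ)) :=
      hw.add (((Complex.continuous_ofReal.tendsto _).comp hK).mul_const ζ)
    refine exists_eq_zero_of_tendsto_ratExp γ β lm P hjp hy
      (tendsto_zero_of_tendsto_mul hM (hF ζ hζ)) ?_
    filter_upwards [(hF ζ hζ).eventually_ne hζ] with n hn
    exact right_ne_zero_of_mul hn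
  have hK₀ : K₀ = 0 := by
    by_contra hne
    have hne' : (K₀ : ℂ) ≠ 0 := by exact_mod_cast hne
    obtain ⟨ζ, hζ, hgζ⟩ := exists_mem_of_eventually_nhdsNE (D := {ζ | g ζ ≠ 0})
      (V := (Set.range fun i => (γ i - w₀) / K₀)ᶜ) hD (Set.finite_range _).isClosed.isOpen_compl
      (Set.finite_range _).infinite_compl.nonempty
    obtain ⟨i, hi⟩ := key ζ hgζ
    exact hζ ⟨i, by simp only; rw [← hi]; field_simp; ring⟩
  refine ⟨hK₀, ?_⟩
  obtain ⟨ζ, -, hζ⟩ := exists_mem_of_eventually_nhdsNE (D := {ζ | g ζ ≠ 0}) hD isOpen_univ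
    Set.univ_nonempty
  simpa [hK₀] using key ζ hζ

lemma eq_power_of_tendsto_zero (hγ : Function.Injective γ) (hγβ : ∀ i j, γ i ≠ β j)
    (hlm : ∀ i, 1 ≤ lm i) {i : Fin m} (hMpos : ∀ᶠ n in u, 0 < M n) (hKpos : ∀ᶠ n in u, 0 < K n)
    (hK : Tendsto K u (𝓝 0)) (hw : Tendsto w u (𝓝 (γ i)))
    (hconst : ∀ c : ℂ, g ≠ fun _ => c)
    (hD : ∀ z, ∀ᶠ y in 𝓝[≠] z, g y ≠ 0)
    (hF : ∀ ζ, g ζ ≠ 0 →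
      Tendsto (fun n => (M n : ℂ) * ratExp γ β lm jp P (w n + K n * ζ)) u (𝓝 (g ζ)))
    (hlim : ∀ ζ c,
      Tendsto (fun n => (M n : ℂ) * ratExp γ β lm jp P (w n + K n * ζ)) u (𝓝 c) → g ζ = c) :
    ∃ (b : ℝ) (C : ℂ), 0 < b ∧
      g = fun ζ => b ^ lm i * zeroCofactor γ β lm jp P i (γ i) * (ζ + C) ^ lm i := by
  set H := zeroCofactor γ β lm jp P i with hH
  have hH0 : H (γ i) ≠ 0 := zeroCofactor_ne_zero lm jp P hγ hγβ i
  have hl0 : lm i ≠ 0 := Nat.one_le_iff_ne_zero.1 (hlm i)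
  set μ : ℕ → ℝ := fun n => M n ^ ((lm i : ℝ)⁻¹) with hμ
  have hμpow : ∀ᶠ n in u, μ n ^ lm i = M n := by
    filter_upwards [hMpos] with n hn
    exact Real.rpow_inv_natCast_pow hn.le hl0
  set q : ℂ → ℕ → ℂ := fun ζ n => μ n * (w n - γ i) + (μ n * K n : ℝ) * ζ with hq
  have hHlim : ∀ ζ, Tendsto (fun n => H (w n + K n * ζ)) u (𝓝 (H (γ i))) := by
    intro ζ
    refine (continuousAt_zeroCofactor lm jp P hγβ i).tendsto.comp ?_
    simpa using hw.add (((Complex.continuous_ofReal.tendsto _).comp hK).mul_const ζ)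
  have hfac : ∀ ζ, ∀ᶠ n in u, (M n : ℂ) * ratExp γ β lm jp P (w n + K n * ζ) =
      q ζ n ^ lm i * H (w n + K n * ζ) := by
    intro ζ
    filter_upwards [hμpow] with n hn
    rw [ratExp_eq_mul_zeroCofactor γ β lm jp P i, ← hn, ← mul_assoc]
    push_cast
    rw [← mul_pow, hq]
    push_cast
    ring
  have hqfin : ∀ ζ, g ζ ≠ 0 → ∃ a, Tendsto (q ζ) u (𝓝 a) := by
    intro ζ hζ
    refine (u.tendsto_nhds_or_cobounded (q ζ)).resolve_right fun hinf => ?_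
    have h₁ := ((hF ζ hζ).congr' (hfac ζ)).div (hHlim ζ) hH0
    have h₂ : Tendsto (fun n => q ζ n ^ lm i) u (𝓝 (g ζ / H (γ i))) := by
      refine h₁.congr' ?_
      filter_upwards [(hHlim ζ).eventually_ne hH0] with n hn
      simp [hn]
    have h₃ : Tendsto (fun n => ‖q ζ n‖ ^ lm i) u atTop :=
      (tendsto_pow_atTop hl0).comp (tendsto_norm_atTop_iff_cobounded.2 hinf)
    have h₄ := h₂.norm
    simp only [norm_pow] at h₄
    exact not_tendsto_nhds_of_tendsto_atTop h₃ _ h₄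
  obtain ⟨ζ₁, -, hζ₁⟩ := exists_mem_of_eventually_nhdsNE (D := {ζ | g ζ ≠ 0}) hD isOpen_univ
    Set.univ_nonempty
  obtain ⟨ζ₂, hne, hζ₂⟩ := exists_mem_of_eventually_nhdsNE (D := {ζ | g ζ ≠ 0}) hD
    (isOpen_compl_singleton (x := ζ₁)) ⟨ζ₁ + 1, by simp⟩
  have hne : ζ₂ - ζ₁ ≠ 0 := sub_ne_zero.2 hne
  obtain ⟨a₁, h₁⟩ := hqfin ζ₁ hζ₁
  obtain ⟨a₂, h₂⟩ := hqfin ζ₂ hζ₂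
  have hb : Tendsto (fun n => ((μ n * K n : ℝ) : ℂ)) u (𝓝 ((a₂ - a₁) / (ζ₂ - ζ₁))) := by
    refine ((h₂.sub h₁).div_const (ζ₂ - ζ₁)).congr fun n => ?_
    rw [hq]
    field_simp
    ring
  set B := (a₂ - a₁) / (ζ₂ - ζ₁) with hB
  have hbre : Tendsto (fun n => μ n * K n) u (𝓝 B.re) := by
    simpa [Function.comp_def] using (Complex.continuous_re.tendsto _).comp hb
  have hBre : (B.re : ℂ) = B :=
    tendsto_nhds_unique ((Complex.continuous_ofReal.tendsto _).comp hbre) hb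
  have hBnn : 0 ≤ B.re := by
    refine ge_of_tendsto hbre ?_
    filter_upwards [hMpos, hKpos] with n h h'
    positivity
  have hqlim : ∀ ζ, Tendsto (q ζ) u (𝓝 (a₁ + B * (ζ - ζ₁))) := by
    intro ζ
    refine (h₁.add (hb.mul_const (ζ - ζ₁))).congr fun n => ?_
    rw [hq]
    ring
  have hgeq : ∀ ζ, g ζ = (a₁ + B * (ζ - ζ₁)) ^ lm i * H (γ i) := fun ζ =>
    hlim ζ _ ((((hqlim ζ).pow _).mul (hHlim ζ)).congr' ((hfac ζ).mono fun n hn => hn.symm))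
  have hB0 : B ≠ 0 := by
    intro h0
    exact hconst (a₁ ^ lm i * H (γ i)) (funext fun ζ => by rw [hgeq, h0]; simp)
  refine ⟨B.re, a₁ / B - ζ₁, lt_of_le_of_ne hBnn ?_, funext fun ζ => ?_⟩
  · intro h
    rw [← h] at hBre
    exact hB0 (by simpa using hBre.symm)
  · rw [hgeq, hBre, show a₁ + B * (ζ - ζ₁) = B * (ζ + (a₁ / B - ζ₁)) by field_simp; ring, mul_pow]
    ring

lemma eq_exp_of_tendsto_cobounded (hP : P.natDegree ≠ 0)
    (hw : Tendsto w u (Bornology.cobounded ℂ)) (hKw : Tendsto (fun n => (K n : ℂ) / w n) u (𝓝 0))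
    (hconst : ∀ c : ℂ, g ≠ fun _ => c)
    (hD : ∀ z, ∀ᶠ y in 𝓝[≠] z, g y ≠ 0)
    (hF : ∀ ζ, g ζ ≠ 0 →
      Tendsto (fun n => (M n : ℂ) * ratExp γ β lm jp P (w n + K n * ζ)) u (𝓝 (g ζ)))
    (hlim : ∀ ζ c,
      Tendsto (fun n => (M n : ℂ) * ratExp γ β lm jp P (w n + K n * ζ)) u (𝓝 c) → g ζ = c) :
    ∃ A₀ A₁ : ℂ, A₁ ≠ 0 ∧ g = fun ζ => Complex.exp (A₁ * ζ + A₀) := by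
  have ha : P.leadingCoeff ≠ 0 := by
    rw [Polynomial.leadingCoeff_ne_zero]
    rintro rfl
    simp at hP
  have hx : ∀ ζ, Tendsto (fun n => (K n * ζ) / w n) u (𝓝 0) := by
    intro ζ
    have := hKw.mul_const ζ
    rw [zero_mul] at this
    exact this.congr fun n => by ring
  set κ : ℂ := P.natDegree * P.leadingCoeff with hκ
  have hκ0 : κ ≠ 0 := mul_ne_zero (by exact_mod_cast hP) ha
  set r : ℂ → ℕ → ℂ := fun ζ n =>
    ratFun γ β lm jp (w n + K n * ζ) / ratFun γ β lm jp (w n) with hr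
  set s : ℂ → ℕ → ℂ := fun ζ n => polySlope P (w n) (K n * ζ) / w n ^ (P.natDegree - 1) with hs
  set q : ℕ → ℂ := fun n => K n * w n ^ (P.natDegree - 1) with hq
  have hrlim : ∀ ζ, Tendsto (r ζ) u (𝓝 1) := fun ζ => ratFun_shift_ratio γ β lm jp hw (hx ζ)
  have hslim : ∀ ζ, Tendsto (s ζ) u (𝓝 κ) := fun ζ => tendsto_polySlope_div P hw (hx ζ)
  set c : ℕ → ℂ := fun n => M n * ratExp γ β lm jp P (w n) with hc
  have hfac : ∀ ζ, ∀ᶠ n in u, (M n : ℂ) * ratExp γ β lm jp P (w n + K n * ζ) =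
      c n * (r ζ n * Complex.exp (ζ * (q n * s ζ n))) := by
    intro ζ
    filter_upwards [ratFun_eventually_ne_zero γ β lm jp hw,
      hw (Bornology.eventually_ne_cobounded 0)] with n hn hwn
    have hwn : w n ≠ 0 := hwn
    have e : ζ * (q n * s ζ n) = K n * ζ * polySlope P (w n) (K n * ζ) := by
      rw [hq, hs]
      field_simp
    rw [ratExp_add_eq γ β lm jp P hn, e, hc, hr]
    ring
  obtain ⟨ζ₁, -, hζ₁⟩ := exists_mem_of_eventually_nhdsNE (D := {ζ | g ζ ≠ 0}) hD isOpen_univ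
    Set.univ_nonempty
  have hζ₁ : g ζ₁ ≠ 0 := hζ₁
  rcases u.tendsto_nhds_or_cobounded q with ⟨q₀, hq₀⟩ | hqinf
  · have hE : ∀ ζ, Tendsto (fun n => r ζ n * Complex.exp (ζ * (q n * s ζ n))) u
        (𝓝 (Complex.exp (q₀ * κ * ζ))) := by
      intro ζ
      have := (hrlim ζ).mul ((Complex.continuous_exp.tendsto _).comp
        ((hq₀.mul (hslim ζ)).const_mul ζ))
      rw [one_mul, mul_comm ζ] at this
      exact this
    have hcl : Tendsto c u (𝓝 (g ζ₁ / Complex.exp (q₀ * κ * ζ₁))) := by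
      refine (((hF ζ₁ hζ₁).congr' (hfac ζ₁)).div (hE ζ₁) (Complex.exp_ne_zero _)).congr' ?_
      filter_upwards [(hE ζ₁).eventually_ne (Complex.exp_ne_zero _)] with n hn
      exact mul_div_cancel_right₀ _ hn
    set c₀ := g ζ₁ / Complex.exp (q₀ * κ * ζ₁) with hc₀
    have hc₀0 : c₀ ≠ 0 := div_ne_zero hζ₁ (Complex.exp_ne_zero _)
    have hgeq : ∀ ζ, g ζ = c₀ * Complex.exp (q₀ * κ * ζ) := fun ζ =>
      hlim ζ _ ((hcl.mul (hE ζ)).congr' ((hfac ζ).mono fun n hn => hn.symm))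
    refine ⟨Complex.log c₀, q₀ * κ, ?_, funext fun ζ => ?_⟩
    · intro h0
      exact hconst c₀ (funext fun ζ => by rw [hgeq, h0]; simp)
    · rw [hgeq, Complex.exp_add, Complex.exp_log hc₀0, mul_comm]
  · exfalso
    have hqn : Tendsto (fun n => ‖q n‖) u atTop := tendsto_norm_atTop_iff_cobounded.2 hqinf
    obtain ⟨e, he, hel⟩ := (isCompact_sphere (0 : ℂ) 1).ultrafilter_le_nhds
      (u.map fun n => q n / (‖q n‖ : ℂ)) (by
      rw [le_principal_iff, Ultrafilter.coe_map, Filter.mem_map]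
      filter_upwards [hqn.eventually_gt_atTop 0] with n hn
      simp [hn.ne'])
    have hel : Tendsto (fun n => q n / (‖q n‖ : ℂ)) u (𝓝 e) := hel
    have he0 : e ≠ 0 := by
      rintro rfl
      simp at he
    obtain ⟨ζ₂, hpos, hζ₂⟩ := exists_mem_of_eventually_nhdsNE (D := {ζ | g ζ ≠ 0})
      (V := {ζ | 0 < (ζ * (e * κ) - ζ₁ * (e * κ)).re}) hD
      (isOpen_lt continuous_const (by fun_prop))
      ⟨ζ₁ + (e * κ)⁻¹, by
        simp only [Set.mem_ofPred_eq]
        rw [add_mul, inv_mul_cancel₀ (mul_ne_zero he0 hκ0)]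
        simp⟩
    have hζ₂ : g ζ₂ ≠ 0 := hζ₂
    have hre : Tendsto (fun n => (ζ₂ * (q n / (‖q n‖ : ℂ) * s ζ₂ n) -
        ζ₁ * (q n / (‖q n‖ : ℂ) * s ζ₁ n)).re) u
        (𝓝 (ζ₂ * (e * κ) - ζ₁ * (e * κ)).re) :=
      (Complex.continuous_re.tendsto _).comp
        (((hel.mul (hslim ζ₂)).const_mul ζ₂).sub ((hel.mul (hslim ζ₁)).const_mul ζ₁))
    have hinf := Real.tendsto_exp_atTop.comp (hqn.atTop_mul_pos hpos hre)
    have hfin := ((((hF ζ₂ hζ₂).congr' (hfac ζ₂)).div ((hF ζ₁ hζ₁).congr' (hfac ζ₁)) hζ₁).div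
      ((hrlim ζ₂).div (hrlim ζ₁) one_ne_zero) (by simp)).norm
    refine not_tendsto_nhds_of_tendsto_atTop hinf _ (hfin.congr' ?_)
    filter_upwards [((hF ζ₁ hζ₁).congr' (hfac ζ₁)).eventually_ne hζ₁,
      (hrlim ζ₂).eventually_ne one_ne_zero, hqn.eventually_gt_atTop 0] with n h₁ h₂ h₃
    have hc0 : c n ≠ 0 := left_ne_zero_of_mul h₁
    have hr0 : r ζ₁ n ≠ 0 := left_ne_zero_of_mul (right_ne_zero_of_mul h₁)
    have h₃' : (‖q n‖ : ℂ) ≠ 0 := by exact_mod_cast h₃.ne'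
    have hsimp : c n * (r ζ₂ n * Complex.exp (ζ₂ * (q n * s ζ₂ n))) /
        (c n * (r ζ₁ n * Complex.exp (ζ₁ * (q n * s ζ₁ n)))) / (r ζ₂ n / r ζ₁ n) =
        Complex.exp (ζ₂ * (q n * s ζ₂ n) - ζ₁ * (q n * s ζ₁ n)) := by
      rw [Complex.exp_sub]
      field_simp
    simp only [Pi.div_apply]
    rw [hsimp, Complex.norm_exp, Function.comp_apply, ← Complex.re_ofReal_mul]
    congr 2
    field_simp

lemma limit_classification (hγ : Function.Injective γ) (hγβ : ∀ i j, γ i ≠ β j)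
    (hlm : ∀ i, 1 ≤ lm i) (hjp : ∀ j, 1 ≤ jp j) (hP : P.natDegree ≠ 0) (hM : Tendsto M u atTop)
    (hKpos : ∀ᶠ n in u, 0 < K n) (hconst : ∀ c : ℂ, g ≠ fun _ => c)
    (hD : ∀ z, ∀ᶠ y in 𝓝[≠] z, g y ≠ 0)
    (hF : ∀ ζ, g ζ ≠ 0 →
      Tendsto (fun n => (M n : ℂ) * ratExp γ β lm jp P (w n + K n * ζ)) u (𝓝 (g ζ)))
    (hlim : ∀ ζ c,
      Tendsto (fun n => (M n : ℂ) * ratExp γ β lm jp P (w n + K n * ζ)) u (𝓝 c) → g ζ = c) :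
    (∃ (i : Fin m) (b : ℝ) (C : ℂ), 0 < b ∧
      g = fun ζ => b ^ lm i * zeroCofactor γ β lm jp P i (γ i) * (ζ + C) ^ lm i) ∨
    ∃ A₀ A₁ : ℂ, A₁ ≠ 0 ∧ g = fun ζ => Complex.exp (A₁ * ζ + A₀) := by
  rcases u.tendsto_nhds_or_cobounded (fun n => (K n : ℂ)) with ⟨K₁, hK₁⟩ | hKinf
  · have hK₀ : Tendsto K u (𝓝 K₁.re) := by
      simpa [Function.comp_def] using (Complex.continuous_re.tendsto _).comp hK₁
    rcases u.tendsto_nhds_or_cobounded w with ⟨w₀, hw₀⟩ | hwinf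
    · obtain ⟨h0, i, rfl⟩ := exists_zero_limit hjp hM hK₀ hw₀ hD hF
      rw [h0] at hK₀
      exact Or.inl ⟨i, eq_power_of_tendsto_zero hγ hγβ hlm (hM.eventually_gt_atTop 0) hKpos hK₀
        hw₀ hconst hD hF hlim⟩
    · refine Or.inr (eq_exp_of_tendsto_cobounded hP hwinf ?_ hconst hD hF hlim)
      simpa [div_eq_mul_inv] using hK₁.mul (tendsto_inv₀_cobounded.comp hwinf)
  · have hKtop : Tendsto K u atTop := by
      refine (tendsto_norm_atTop_iff_cobounded.2 hKinf).congr' ?_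
      filter_upwards [hKpos] with n hn
      rw [Complex.norm_real, Real.norm_of_nonneg hn.le]
    rcases u.tendsto_nhds_or_cobounded (fun n => w n / K n) with ⟨d, hd⟩ | hinf
    · exact (false_of_dilation_tendsto_atTop hP hM hKtop hd hD hF).elim
    · refine Or.inr (eq_exp_of_tendsto_cobounded hP ?_ ?_ hconst hD hF hlim)
      · rw [← tendsto_norm_atTop_iff_cobounded] at hinf ⊢
        refine (hinf.atTop_mul_atTop₀ hKtop).congr' ?_
        filter_upwards [hKpos] with n hn
        rw [norm_div, Complex.norm_real, Real.norm_of_nonneg hn.le, div_mul_cancel₀ _ hn.ne']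
      · refine (tendsto_inv₀_cobounded.comp hinf).congr fun n => ?_
        simp

end Limit

lemma tendsto_mul_zero_of_norm_le {ι : Type*} {l : Filter ι} {F G : ι → ℂ} {B : ℝ}
    (hF : ∀ n, ‖F n‖ ≤ B) (hG : Tendsto G l (𝓝 0)) : Tendsto (fun n => F n * G n) l (𝓝 0) := by
  refine squeeze_zero_norm (a := fun n => B * ‖G n‖) (fun n => ?_)
    (by simpa using hG.norm.const_mul B)
  rw [norm_mul]
  exact mul_le_mul_of_nonneg_right (hF n) (norm_nonneg _)

section Realization

variable {m p : ℕ} {γ : Fin m → ℂ} {β : Fin p → ℂ} {lm : Fin m → ℕ} {jp : Fin p → ℕ}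
  {P : Polynomial ℂ} {α : ℝ}

lemma power_mem_piAlpha (hγ : Function.Injective γ) (hγβ : ∀ i j, γ i ≠ β j)
    (hlm : ∀ i, 1 ≤ lm i) (hα₁ : 0 < α) (hα₂ : α < 1) (i : Fin m) {t : ℝ} (ht : 0 < t) (C : ℂ) :
    (fun ζ => t * zeroCofactor γ β lm jp P i (γ i) * (ζ + C) ^ lm i) ∈
      PiAlpha α (ratExp γ β lm jp P) := by
  have hl0 : lm i ≠ 0 := Nat.one_le_iff_ne_zero.1 (hlm i)
  have hl1 : (1 : ℝ) ≤ lm i := by exact_mod_cast hlm i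
  have hlα : 0 < (lm i : ℝ) - α := by linarith
  set H := zeroCofactor γ β lm jp P i with hH
  have hH0 : H (γ i) ≠ 0 := zeroCofactor_ne_zero lm jp P hγ hγβ i
  set ρ : ℕ → ℝ := fun n => (t / ((n + 1 : ℕ) : ℝ) ^ lm i) ^ (((lm i : ℝ) - α)⁻¹) with hρ
  have hρpos : ∀ n, 0 < ρ n := fun n => by positivity
  have hnat : Tendsto (fun n : ℕ => ((n + 1 : ℕ) : ℝ)) atTop atTop :=
    tendsto_natCast_atTop_atTop.comp (tendsto_add_atTop_nat 1)
  have hρ0 : Tendsto ρ atTop (𝓝 0) := by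
    have h₁ : Tendsto (fun n : ℕ => t / ((n + 1 : ℕ) : ℝ) ^ lm i) atTop (𝓝 0) :=
      tendsto_const_nhds.div_atTop ((tendsto_pow_atTop hl0).comp hnat)
    have h₂ := h₁.rpow_const (p := ((lm i : ℝ) - α)⁻¹) (Or.inr (by positivity))
    rwa [Real.zero_rpow (by positivity)] at h₂
  set K : ℕ → ℝ := fun n => ((n + 1 : ℕ) : ℝ) * ρ n with hK
  have hKρ : ∀ n, ρ n ^ (-α) * K n ^ lm i = t := by
    intro n
    have h₁ : ρ n ^ (-α) * ρ n ^ lm i = t / ((n + 1 : ℕ) : ℝ) ^ lm i := by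
      rw [← Real.rpow_natCast, ← Real.rpow_add (hρpos n), hρ, ← Real.rpow_mul (by positivity),
        neg_add_eq_sub, inv_mul_cancel₀ hlα.ne', Real.rpow_one]
    rw [hK, mul_pow, mul_left_comm, h₁]
    have : ((n + 1 : ℕ) : ℝ) ≠ 0 := by positivity
    field_simp
  have hK0 : Tendsto K atTop (𝓝 0) := by
    have h₁ : Tendsto (fun n => t * ρ n ^ α) atTop (𝓝 0) := by
      have := (hρ0.rpow_const (p := α) (Or.inr hα₁.le)).const_mul t
      rwa [Real.zero_rpow hα₁.ne', mul_zero] at this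
    have h₂ := h₁.rpow_const (p := (lm i : ℝ)⁻¹) (Or.inr (by positivity))
    rw [Real.zero_rpow (by positivity)] at h₂
    refine h₂.congr fun n => ?_
    have hKpos : 0 ≤ K n := mul_nonneg (by positivity) (hρpos n).le
    rw [← hKρ n, mul_right_comm, ← Real.rpow_add (hρpos n), neg_add_cancel, Real.rpow_zero,
      one_mul, Real.pow_rpow_inv_natCast hKpos hl0]
  refine ⟨?_, ?_, 0, fun n => n + 1, fun n => γ i / ((n + 1 : ℕ) : ℂ) + ρ n * C, ρ,
    tendsto_add_atTop_nat 1, ?_, hρpos, hρ0, ?_⟩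
  · intro z _
    exact AnalyticAt.meromorphicAt (by fun_prop)
  · intro c hc
    have h₁ := congrFun hc (-C)
    have h₂ := congrFun hc (-C + 1)
    have htC : (t : ℂ) ≠ 0 := by exact_mod_cast ht.ne'
    simp only [neg_add_cancel, zero_pow hl0, mul_zero] at h₁
    rw [← h₁] at h₂
    simp [htC, hH0] at h₂
  · have h₁ : Tendsto (fun n : ℕ => γ i / ((n + 1 : ℕ) : ℂ)) atTop (𝓝 0) :=
      (tendsto_const_div_atTop_nhds_zero_nat (γ i)).comp (tendsto_add_atTop_nat 1)
    have h₂ := ((Complex.continuous_ofReal.tendsto _).comp hρ0).mul_const C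
    simpa using h₁.add h₂
  · refine sphLocUnifConv_of_tendsto (fun ζ => ?_) (by fun_prop)
    have hKC : Tendsto (fun q : ℕ × ℂ => (K q.1 : ℂ)) (atTop ×ˢ 𝓝 ζ) (𝓝 0) := by
      simpa [Function.comp_def] using
        ((Complex.continuous_ofReal.tendsto _).comp hK0).comp tendsto_fst
    have hζ : Tendsto (fun q : ℕ × ℂ => q.2 + C) (atTop ×ˢ 𝓝 ζ) (𝓝 (ζ + C)) :=
      tendsto_snd.add_const C
    have harg : Tendsto (fun q : ℕ × ℂ => γ i + K q.1 * (q.2 + C)) (atTop ×ˢ 𝓝 ζ) (𝓝 (γ i)) := by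
      simpa using (hKC.mul hζ).const_add (γ i)
    have hHl := (continuousAt_zeroCofactor lm jp P hγβ i).tendsto.comp harg
    refine ((hHl.const_mul (t : ℂ)).mul (hζ.pow (lm i))).congr fun q => ?_
    have hq : ((q.1 + 1 : ℕ) : ℂ) ≠ 0 := Nat.cast_ne_zero.2 (Nat.succ_ne_zero _)
    have e : ((q.1 + 1 : ℕ) : ℂ) * (γ i / ((q.1 + 1 : ℕ) : ℂ) + ρ q.1 * C) +
        ((q.1 + 1 : ℕ) : ℂ) * ρ q.1 * q.2 = γ i + K q.1 * (q.2 + C) := by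
      rw [hK, Complex.ofReal_mul, Complex.ofReal_natCast]
      field_simp
      ring
    rw [e, ratExp_eq_mul_zeroCofactor γ β lm jp P i, ← hKρ q.1, Function.comp_apply,
      add_sub_cancel_left, mul_pow (K q.1 : ℂ), Complex.ofReal_mul, Complex.ofReal_pow]
    ring

/-- A `(k - 1)`-th root `y` of `c` can be chosen so that `a * y ^ k` has nonpositive real part. -/
lemma exists_pow_eq_and_re_nonpos (a c : ℂ) {k : ℕ} (hk : 3 ≤ k) :
    ∃ y : ℂ, y ^ (k - 1) = c ∧ (a * y ^ k).re ≤ 0 := by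
  obtain ⟨y, hy⟩ := IsAlgClosed.exists_pow_nat_eq c (show 0 < k - 1 by omega)
  set ω := Complex.exp (2 * Real.pi * Complex.I / (k - 1 : ℕ)) with hω
  have hprim : IsPrimitiveRoot ω (k - 1) := Complex.isPrimitiveRoot_exp _ (by omega)
  have hroot : ∀ i, (y * ω ^ i) ^ (k - 1) = c := by
    intro i
    rw [mul_pow, hy, ← pow_mul, mul_comm i, pow_mul, hprim.pow_eq_one, one_pow, mul_one]
  have hsum : ∑ i ∈ Finset.range (k - 1), (a * (y * ω ^ i) ^ k).re = 0 := by
    have e : ∀ i, a * (y * ω ^ i) ^ k = a * c * y * ω ^ i := by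
      intro i
      obtain ⟨j, rfl⟩ : ∃ j, k = j + 1 := ⟨k - 1, by omega⟩
      have := hroot i
      rw [add_tsub_cancel_right] at this
      rw [pow_succ, this]
      ring
    simp only [e]
    rw [← Complex.re_sum, ← Finset.mul_sum, hprim.geom_sum_eq_zero (by omega)]
    simp
  by_contra! h
  have := Finset.sum_pos (fun i _ => h _ (hroot i)) (s := Finset.range (k - 1))
    (Finset.nonempty_range_iff.2 (by omega))
  exact this.ne' hsum

lemma exists_near_re_mul_pow_neg {a y : ℂ} (ha : a ≠ 0) (hy : y ≠ 0) {k : ℕ} (hk : k ≠ 0)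
    (h : (a * y ^ k).re ≤ 0) : ∃ᶠ y' in 𝓝 y, (a * y' ^ k).re < 0 := by
  have hd : HasStrictDerivAt (fun z : ℂ => a * z ^ k) (a * (k * y ^ (k - 1))) y :=
    (hasStrictDerivAt_pow k y).const_mul a
  have hmap := hd.map_nhds_eq (by positivity)
  have hfreq : ∃ᶠ b in 𝓝 (a * y ^ k), b.re < 0 := by
    have ht : Tendsto (fun δ : ℝ => a * y ^ k - δ) (𝓝[>] 0) (𝓝 (a * y ^ k)) := by
      have : Continuous fun δ : ℝ => a * y ^ k - (δ : ℂ) := by fun_prop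
      simpa using (this.tendsto 0).mono_left nhdsWithin_le_nhds
    refine ht.frequently (Eventually.frequently ?_)
    filter_upwards [self_mem_nhdsWithin] with δ hδ
    have hδ : 0 < δ := hδ
    rw [Complex.sub_re, Complex.ofReal_re]
    linarith
  rw [← hmap] at hfreq
  exact hfreq

lemma tendsto_rpow_norm_ratExp_mul_pow (hP : P.natDegree ≠ 0) (hα : 0 < α) {E : ℝ} (hE : 0 < E)
    {y : ℂ} (hy : (P.leadingCoeff * y ^ P.natDegree).re < 0) :
    Tendsto (fun s : ℝ => (‖ratExp γ β lm jp P (s * y)‖ / E) ^ α⁻¹ * s ^ P.natDegree) atTop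
      (𝓝 0) := by
  have hy0 : y ≠ 0 := by
    rintro rfl
    simp [hP] at hy
  have hpow : Tendsto (fun s : ℝ => s ^ P.natDegree) atTop atTop := tendsto_pow_atTop hP
  have hlogf := tendsto_log_norm_ratExp_div γ β lm jp P (tendsto_id (α := ℝ) (x := atTop))
    (tendsto_const_nhds (x := y)) hy0 hP
  have hlogs : Tendsto (fun s : ℝ => Real.log s / s ^ P.natDegree) atTop (𝓝 0) := by
    have := (isLittleO_log_rpow_atTop (r := P.natDegree) (by positivity)).tendsto_div_nhds_zero
    simpa using this
  have hlogE : Tendsto (fun s : ℝ => Real.log E / s ^ P.natDegree) atTop (𝓝 0) :=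
    tendsto_const_nhds.div_atTop hpow
  have hL := ((hlogf.sub hlogE).mul_const α⁻¹).add (hlogs.const_mul (P.natDegree : ℝ))
  have hneg : ((P.leadingCoeff * y ^ P.natDegree).re - 0) * α⁻¹ + P.natDegree * 0 < 0 := by
    rw [sub_zero, mul_zero, add_zero]
    exact mul_neg_of_neg_of_pos hy (inv_pos.2 hα)
  refine (Real.tendsto_exp_atBot.comp (hL.neg_mul_atTop hneg hpow)).congr' ?_
  filter_upwards [eventually_gt_atTop 0, ratFun_eventually_ne_zero γ β lm jp
    (tendsto_ofReal_mul_cobounded tendsto_id (tendsto_const_nhds (x := y)) hy0)] with s hs hR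
  have hf : 0 < ‖ratExp γ β lm jp P (s * y)‖ :=
    norm_pos_iff.2 (mul_ne_zero hR (Complex.exp_ne_zero _))
  have hs' : 0 < s ^ P.natDegree := by positivity
  rw [Real.rpow_def_of_pos (by positivity), Real.log_div hf.ne' hE.ne']
  have hpe : s ^ P.natDegree = Real.exp (P.natDegree * Real.log s) := by
    rw [← Real.log_pow, Real.exp_log hs']
  conv_rhs => rw [hpe, ← Real.exp_add]
  rw [Function.comp_apply]
  congr 1
  simp only [id]
  field_simp

lemma exp_mem_piAlpha (hP : 3 ≤ P.natDegree) (hα : 0 < α) (A₀ : ℂ) {A₁ : ℂ}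
    (hA₁ : A₁ ≠ 0) :
    (fun ζ => Complex.exp (A₁ * ζ + A₀)) ∈ PiAlpha α (ratExp γ β lm jp P) := by
  have hP0 : P.natDegree ≠ 0 := by omega
  have ha : P.leadingCoeff ≠ 0 := by
    rw [Polynomial.leadingCoeff_ne_zero]
    rintro rfl
    simp at hP0
  set κ : ℂ := P.natDegree * P.leadingCoeff with hκ
  have hκ0 : κ ≠ 0 := mul_ne_zero (by exact_mod_cast hP0) ha
  set k := P.natDegree with hk
  set f := ratExp γ β lm jp P with hf
  set E : ℝ := Real.exp A₀.re with hE
  have hEpos : 0 < E := Real.exp_pos _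
  obtain ⟨y₀, hy₀pow, hy₀re⟩ := exists_pow_eq_and_re_nonpos P.leadingCoeff (A₁ / κ) hP
  have hy₀ : y₀ ≠ 0 := by
    rintro rfl
    rw [zero_pow (by omega)] at hy₀pow
    exact div_ne_zero hA₁ hκ0 hy₀pow.symm
  have hchoice : ∀ n : ℕ, ∃ (s : ℝ) (y : ℂ), (n + 1 : ℝ) ≤ s ∧ dist y y₀ < 1 / (n + 1 : ℝ) ∧
      ratFun γ β lm jp (s * y) ≠ 0 ∧ (‖f (s * y)‖ / E) ^ α⁻¹ * s ^ k < 1 / (n + 1 : ℝ) := by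
    intro n
    have hn : (0 : ℝ) < 1 / (n + 1 : ℝ) := by positivity
    obtain ⟨y, hyre, hyd⟩ := ((exists_near_re_mul_pow_neg ha hy₀ hP0 hy₀re).and_eventually
      (Metric.ball_mem_nhds y₀ hn)).exists
    have hy0 : y ≠ 0 := by
      rintro rfl
      simp [hP0] at hyre
    obtain ⟨s, hs₁, hs₂, hs₃⟩ := ((eventually_ge_atTop (n + 1 : ℝ)).and
      ((ratFun_eventually_ne_zero γ β lm jp (tendsto_ofReal_mul_cobounded tendsto_id
        (tendsto_const_nhds (x := y)) hy0)).and
      ((tendsto_rpow_norm_ratExp_mul_pow hP0 hα hEpos hyre).eventually_lt_const hn))).exists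
    exact ⟨s, y, hs₁, hyd, hs₂, hs₃⟩
  choose s y hs hy hR hsmall using hchoice
  have hone : Tendsto (fun n : ℕ => 1 / (n + 1 : ℝ)) atTop (𝓝 0) :=
    tendsto_one_div_add_atTop_nhds_zero_nat
  have hs1 : ∀ n, 1 ≤ s n := fun n => le_trans (by simp) (hs n)
  have hspos : ∀ n, 0 < s n := fun n => one_pos.trans_le (hs1 n)
  have hsTop : Tendsto s atTop atTop := by
    refine tendsto_atTop_mono (fun n => ?_) tendsto_natCast_atTop_atTop
    linarith [hs n]
  have hyl : Tendsto y atTop (𝓝 y₀) :=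
    tendsto_iff_dist_tendsto_zero.2
      (squeeze_zero (fun _ => dist_nonneg) (fun n => (hy n).le) hone)
  set v : ℕ → ℂ := fun n => s n * y n with hv
  have hvinf : Tendsto v atTop (Bornology.cobounded ℂ) :=
    tendsto_ofReal_mul_cobounded hsTop hyl hy₀
  have hfv : ∀ n, f (v n) ≠ 0 := fun n => mul_ne_zero (hR n) (Complex.exp_ne_zero _)
  set ρ : ℕ → ℝ := fun n => (‖f (v n)‖ / E) ^ α⁻¹ with hρ
  have hρpos : ∀ n, 0 < ρ n := fun n =>
    Real.rpow_pos_of_pos (div_pos (norm_pos_iff.2 (hfv n)) hEpos) _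
  have hρα : ∀ n, ρ n ^ (-α) = E / ‖f (v n)‖ := by
    intro n
    rw [hρ, ← Real.rpow_mul (by positivity), mul_neg, inv_mul_cancel₀ hα.ne',
      Real.rpow_neg_one, inv_div]
  have hρs : Tendsto (fun n => ρ n * s n ^ k) atTop (𝓝 0) :=
    squeeze_zero (fun n => mul_nonneg (hρpos n).le (pow_nonneg (hspos n).le _))
      (fun n => (hsmall n).le) hone
  have hρ0 : Tendsto ρ atTop (𝓝 0) :=
    squeeze_zero (fun n => (hρpos n).le)
      (fun n => le_mul_of_one_le_right (hρpos n).le (one_le_pow₀ (hs1 n))) hρs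
  set τ : ℕ → ℝ := fun n => ρ n * s n ^ (k - 1) with hτ
  have hτpos : ∀ n, 0 < τ n := fun n => mul_pos (hρpos n) (pow_pos (hspos n) _)
  have hτ0 : Tendsto τ atTop (𝓝 0) :=
    squeeze_zero (fun n => (hτpos n).le) (fun n => mul_le_mul_of_nonneg_left
      (pow_le_pow_right₀ (hs1 n) (Nat.sub_le _ _)) (hρpos n).le) hρs
  set N : ℕ → ℕ := fun n => ⌈(τ n)⁻¹⌉₊ with hN
  have hNle : ∀ n, (τ n)⁻¹ ≤ N n := fun n => Nat.le_ceil _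
  have hNlt : ∀ n, (N n : ℝ) < (τ n)⁻¹ + 1 := fun n => Nat.ceil_lt_add_one (inv_pos.2 (hτpos n)).le
  have hNpos : ∀ n, (0 : ℝ) < N n := fun n => (inv_pos.2 (hτpos n)).trans_le (hNle n)
  have hNtop : Tendsto (fun n => (N n : ℝ)) atTop atTop :=
    tendsto_atTop_mono hNle (tendsto_inv_nhdsGT_zero.comp
      (tendsto_nhdsWithin_iff.2 ⟨hτ0, Eventually.of_forall hτpos⟩))
  have hNinv : Tendsto (fun n => ((N n : ℂ))⁻¹) atTop (𝓝 0) := by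
    have := (Complex.continuous_ofReal.tendsto _).comp (tendsto_inv_atTop_zero.comp hNtop)
    simpa [Function.comp_def] using this
  set K : ℕ → ℝ := fun n => N n * ρ n with hK
  have hKs : Tendsto (fun n => K n * s n ^ (k - 1)) atTop (𝓝 1) := by
    have e : ∀ n, K n * s n ^ (k - 1) = N n * τ n := fun n => by rw [hK, hτ]; ring
    simp only [e]
    refine tendsto_of_tendsto_of_tendsto_of_le_of_le tendsto_const_nhds
      (h := fun n => 1 + τ n) (by simpa using hτ0.const_add 1) (fun n => ?_) (fun n => ?_)
    · have := mul_le_mul_of_nonneg_right (hNle n) (hτpos n).le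
      rwa [inv_mul_cancel₀ (hτpos n).ne'] at this
    · have := mul_le_mul_of_nonneg_right (hNlt n).le (hτpos n).le
      rwa [add_mul, inv_mul_cancel₀ (hτpos n).ne', one_mul] at this
  have hKv : Tendsto (fun n => K n * v n ^ (k - 1)) atTop (𝓝 (A₁ / κ)) := by
    have := ((Complex.continuous_ofReal.tendsto _).comp hKs).mul (hyl.pow (k - 1))
    rw [Complex.ofReal_one, one_mul, hy₀pow] at this
    refine this.congr fun n => ?_
    rw [hv, Function.comp_apply, mul_pow]
    push_cast
    ring
  have hvinv : Tendsto (fun n => (v n)⁻¹) atTop (𝓝 0) := tendsto_inv₀_cobounded.comp hvinf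
  have hv0 : ∀ᶠ n in atTop, v n ≠ 0 := hvinf (Bornology.eventually_ne_cobounded 0)
  have hk1 : k - 1 ≠ 0 := by omega
  have hKl : Tendsto (fun n => (K n : ℂ)) atTop (𝓝 0) := by
    have := hKv.mul (hvinv.pow (k - 1))
    rw [zero_pow hk1, mul_zero] at this
    refine this.congr' ?_
    filter_upwards [hv0] with n hn
    rw [inv_pow]
    field_simp
  set φ : ℕ → ℝ := fun n => A₀.im - Complex.arg (f (v n)) with hφ
  have hφbd : ∀ n, ‖(φ n * Complex.I / κ : ℂ)‖ ≤ (|A₀.im| + Real.pi) / ‖κ‖ := by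
    intro n
    rw [norm_div, norm_mul, Complex.norm_I, mul_one, Complex.norm_real, Real.norm_eq_abs]
    gcongr
    exact (abs_sub _ _).trans (by gcongr; exact Complex.abs_arg_le_pi _)
  set η : ℕ → ℂ := fun n => φ n * Complex.I / κ * (v n)⁻¹ ^ (k - 1) with hη
  have hηl : Tendsto η atTop (𝓝 0) := by
    have := hvinv.pow (k - 1)
    rw [zero_pow hk1] at this
    exact tendsto_mul_zero_of_norm_le hφbd this
  refine ⟨?_, ?_, 0, N, fun n => (v n + η n) / N n, ρ, ?_, ?_, hρpos, hρ0, ?_⟩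
  · intro z _
    exact AnalyticAt.meromorphicAt (by fun_prop)
  · intro c hc
    have hd : HasDerivAt (fun ζ : ℂ => Complex.exp (A₁ * ζ + A₀))
        (Complex.exp (A₁ * 0 + A₀) * (A₁ * 1)) 0 :=
      (((hasDerivAt_id (0 : ℂ)).const_mul A₁).add_const A₀).cexp
    rw [hc] at hd
    have := hd.unique (hasDerivAt_const 0 c)
    simp [hA₁] at this
  · exact tendsto_natCast_atTop_iff.1 hNtop
  · have h₁ : Tendsto (fun n => v n / N n) atTop (𝓝 0) := by
      have hb : Tendsto (fun n => ‖y n‖ * (ρ n * s n ^ k)) atTop (𝓝 0) := by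
        simpa using hyl.norm.mul hρs
      refine squeeze_zero_norm (fun n => ?_) hb
      have hNi : ((N n : ℝ))⁻¹ ≤ τ n := inv_le_of_inv_le₀ (hτpos n) (hNle n)
      rw [norm_div, hv, norm_mul, Complex.norm_real, Real.norm_of_nonneg (hspos n).le,
        Complex.norm_natCast, div_eq_mul_inv]
      calc s n * ‖y n‖ * ((N n : ℝ))⁻¹ ≤ s n * ‖y n‖ * τ n := by
            have := (hspos n).le
            gcongr
        _ = ‖y n‖ * (ρ n * s n ^ k) := by
            rw [hτ, ← Nat.sub_add_cancel (show 1 ≤ k by omega), pow_succ, Nat.add_sub_cancel]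
            ring
    have h₂ : Tendsto (fun n => η n / N n) atTop (𝓝 0) := by
      simpa [div_eq_mul_inv] using hηl.mul hNinv
    simpa [add_div] using h₁.add h₂
  · refine sphLocUnifConv_of_tendsto (fun ζ => ?_) (by fun_prop)
    set L : Filter (ℕ × ℂ) := atTop ×ˢ 𝓝 ζ with hL
    have hfst : Tendsto (Prod.fst : ℕ × ℂ → ℕ) L atTop := tendsto_fst
    have hsnd : Tendsto (Prod.snd : ℕ × ℂ → ℂ) L (𝓝 ζ) := tendsto_snd
    set x : ℕ × ℂ → ℂ := fun q => η q.1 + K q.1 * q.2 with hx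
    have hvL : Tendsto (fun q : ℕ × ℂ => v q.1) L (Bornology.cobounded ℂ) := hvinf.comp hfst
    have hxL : Tendsto (fun q : ℕ × ℂ => x q / v q.1) L (𝓝 0) := by
      have h₁ : Tendsto x L (𝓝 0) := by
        simpa using (hηl.comp hfst).add ((hKl.comp hfst).mul hsnd)
      simpa [div_eq_mul_inv] using h₁.mul (hvinv.comp hfst)
    have hr := ratFun_shift_ratio γ β lm jp hvL hxL
    set σ : ℕ × ℂ → ℂ := fun q => polySlope P (v q.1) (x q) / v q.1 ^ (P.natDegree - 1) with hσdef
    have hσ : Tendsto σ L (𝓝 κ) := tendsto_polySlope_div P hvL hxL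
    have hσ0 : Tendsto (fun q => φ q.1 * Complex.I / κ * (σ q - κ)) L (𝓝 0) := by
      refine tendsto_mul_zero_of_norm_le (fun q => hφbd q.1) ?_
      simpa using hσ.sub_const κ
    have hexp : Tendsto (fun q : ℕ × ℂ => φ q.1 * Complex.I / κ * (σ q - κ) +
        K q.1 * v q.1 ^ (k - 1) * q.2 * σ q) L (𝓝 (A₁ * ζ)) := by
      have := hσ0.add (((hKv.comp hfst).mul hsnd).mul hσ)
      rw [zero_add, show A₁ / κ * ζ * κ = A₁ * ζ by field_simp] at this
      exact this
    have hmain := (hr.mul ((Complex.continuous_exp.tendsto _).comp hexp)).const_mul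
      (Complex.exp A₀)
    rw [one_mul, ← Complex.exp_add, add_comm A₀] at hmain
    refine hmain.congr' ?_
    filter_upwards [hfst hv0] with q hvq
    have hvq : v q.1 ≠ 0 := hvq
    have hNq : (N q.1 : ℂ) ≠ 0 := by
      have := (hNpos q.1).ne'
      exact_mod_cast this
    have harg : (N q.1 : ℂ) * ((v q.1 + η q.1) / N q.1) + N q.1 * ρ q.1 * q.2 =
        v q.1 + x q := by
      rw [mul_div_cancel₀ _ hNq, hx, hK]
      push_cast
      ring
    have hxS : x q * polySlope P (v q.1) (x q) = φ q.1 * Complex.I +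
        (φ q.1 * Complex.I / κ * (σ q - κ) + K q.1 * v q.1 ^ (k - 1) * q.2 * σ q) := by
      have h₁ : polySlope P (v q.1) (x q) = σ q * v q.1 ^ (k - 1) :=
        (div_mul_cancel₀ _ (pow_ne_zero _ hvq)).symm
      have h₂ : x q * v q.1 ^ (k - 1) =
          φ q.1 * Complex.I / κ + K q.1 * v q.1 ^ (k - 1) * q.2 := by
        simp only [hx, hη, inv_pow]
        field_simp
      have h₃ : φ q.1 * Complex.I / κ * κ = φ q.1 * Complex.I := by field_simp
      rw [h₁]
      linear_combination σ q * h₂ + h₃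
    have hpolar : ((ρ q.1 ^ (-α) : ℝ) : ℂ) * f (v q.1) * Complex.exp (φ q.1 * Complex.I) =
        Complex.exp A₀ := by
      have hn : (‖f (v q.1)‖ : ℂ) ≠ 0 := by
        simpa using hfv q.1
      rw [hρα]
      nth_rewrite 2 [← Complex.norm_mul_exp_arg_mul_I (f (v q.1))]
      push_cast
      rw [hE, Complex.ofReal_exp, div_mul_eq_mul_div, mul_div_assoc, mul_div_cancel_left₀ _ hn,
        mul_assoc, ← Complex.exp_add, ← Complex.exp_add]
      congr 1
      rw [hφ]
      push_cast
      nth_rewrite 3 [← Complex.re_add_im A₀]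
      ring
    have hadd : f (v q.1 + x q) = f (v q.1) * (ratFun γ β lm jp (v q.1 + x q) /
        ratFun γ β lm jp (v q.1) * Complex.exp (x q * polySlope P (v q.1) (x q))) :=
      ratExp_add_eq γ β lm jp P (hR q.1)
    rw [harg, hadd, hxS, Complex.exp_add, ← hpolar, Function.comp_apply]
    ring

end Realization

/-- (Theorem 1, case `k ≥ 3`, `0 < α < 1`) For `f = R·e^P` with
`deg P = k ≥ 3`:
`Π_α(f) = ⋃ᵢ { ζ ↦ e^{P(γ i)}·A·(ζ + C)^(l i) : arg A = arg R̃_{γ i}(γ i), C ∈ ℂ } ∪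
{ ζ ↦ e^{A₁ζ + A₀} : A₀ ∈ ℂ, A₁ ≠ 0 }`. -/
theorem piAlpha_pos_higher
    (m p : ℕ) (γ : Fin m → ℂ) (β : Fin p → ℂ)
    (hγ : Function.Injective γ) (hβ : Function.Injective β) (hγβ : ∀ i j, γ i ≠ β j)
    (lm : Fin m → ℕ) (hlm : ∀ i, 1 ≤ lm i) (jp : Fin p → ℕ) (hjp : ∀ j, 1 ≤ jp j)
    (R : ℂ → ℂ) (hR : R = fun z => (∏ i, (z - γ i) ^ lm i) / ∏ j, (z - β j) ^ jp j)
    (P : Polynomial ℂ) (k : ℕ) (hk : 3 ≤ k) (hdeg : P.natDegree = k)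
    (f : ℂ → ℂ) (hf : f = fun z => R z * Complex.exp (P.eval z))
    (α : ℝ) (hα₁ : 0 < α) (hα₂ : α < 1) :
    PiAlpha α f =
      { g | (∃ (i : Fin m) (A C : ℂ),
              (∃ t : ℝ, 0 < t ∧ A = (t : ℂ) *
                ((∏ j ∈ Finset.univ.erase i, (γ i - γ j) ^ lm j) /
                  ∏ j, (γ i - β j) ^ jp j)) ∧
              g = fun ζ => Complex.exp (P.eval (γ i)) * A * (ζ + C) ^ lm i) ∨
            (∃ A₀ A₁ : ℂ, A₁ ≠ 0 ∧ g = fun ζ => Complex.exp (A₁ * ζ + A₀)) } := by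
  have hfR : f = ratExp γ β lm jp P := by rw [hf, hR]; rfl
  subst hdeg
  rw [hfR]
  ext g
  constructor
  · rintro ⟨hmero, hconst, -, N, z, ρ, hN, -, hρpos, hρ0, hconv⟩
    have hcont : ∀ n ζ, ContinuousAt (fun ζ => ((ρ n ^ (-α) : ℝ) : ℂ) *
        ratExp γ β lm jp P ((N n : ℂ) * z n + (N n : ℂ) * (ρ n : ℂ) * ζ)) ζ ∨
        ((ρ n ^ (-α) : ℝ) : ℂ) *
          ratExp γ β lm jp P ((N n : ℂ) * z n + (N n : ℂ) * (ρ n : ℂ) * ζ) = 0 := by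
      intro n ζ
      by_cases h : ∃ j, (N n : ℂ) * z n + (N n : ℂ) * (ρ n : ℂ) * ζ = β j
      · obtain ⟨j, hj⟩ := h
        right
        rw [hj, ratExp_eq_zero_of_pole γ β lm P hjp j, mul_zero]
      · left
        push Not at h
        refine continuousAt_const.mul
          (ContinuousAt.comp (f := fun ζ : ℂ => (N n : ℂ) * z n + (N n : ℂ) * (ρ n : ℂ) * ζ)
            (continuousAt_ratExp γ β lm jp P h) (by fun_prop))
    have hD := hconv.eventually_ne_zero hcont hmero hconst
    set u : Ultrafilter ℕ := hyperfilter ℕ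
    have hu : (u : Filter ℕ) ≤ atTop := Nat.hyperfilter_le_atTop
    have hM : Tendsto (fun n => ρ n ^ (-α)) u atTop :=
      ((tendsto_rpow_neg_nhdsGT_zero (neg_lt_zero.2 hα₁)).comp
        (tendsto_nhdsWithin_iff.2 ⟨hρ0, Eventually.of_forall hρpos⟩)).mono_left hu
    have hKpos : ∀ᶠ n in u, 0 < N n * ρ n := by
      filter_upwards [hu (hN.eventually_gt_atTop 0)] with n hn
      exact mul_pos (by exact_mod_cast hn) (hρpos n)
    rcases limit_classification (γ := γ) (β := β) (lm := lm) (jp := jp) (P := P)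
      (w := fun n => N n * z n) (K := fun n => N n * ρ n) hγ hγβ hlm hjp (by omega) hM hKpos hconst
      hD (fun ζ hζ => by simpa using (hconv.tendsto_of_ne_zero hζ).mono_left hu)
      (fun ζ c hc => hconv.eq_of_tendsto hu (by simpa using hc)) with ⟨i, b, C, hb, hg⟩ | h
    · refine Or.inl ⟨i, _, C, ⟨b ^ lm i, pow_pos hb _, rfl⟩, ?_⟩
      rw [hg]
      funext ζ
      rw [zeroCofactor]
      push_cast
      ring
    · exact Or.inr h
  · rintro (⟨i, A, C, ⟨t, ht, rfl⟩, rfl⟩ | ⟨A₀, A₁, hA₁, rfl⟩)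
    · convert power_mem_piAlpha (jp := jp) (P := P) hγ hγβ hlm hα₁ hα₂ i ht C using 2 with ζ
      rw [zeroCofactor]
      ring
    · exact exp_mem_piAlpha hk hα₁ A₀ hA₁
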